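/- arXiv:1808.07576 — 3 statements merged into one kernel-verified Lean document; each statement's English description precedes it below -/
import Mathlib

section
/- Let m ≥ 2 and 0 < α < 2/(m+1). The eigenvalues of the (m+1)×(m+1) matrix W_α (counted with multiplicity) are: 1−α with multiplicity m−1, the value 1, and the value 1−(m+1)α. Consequently, the maximum absolute value among the eigenvalues other than the single eigenvalue 1 equals max{|1−α|, |1−(m+1)α|}. -/
open Polynomial

/-- The EASGD mixing matrix `W_α = [[(1−α)·I_m, α·1_m], [α·1_mᵀ, 1−mα]]`
of size `(m+1)×(m+1)`, with the first `m` indices corresponding to the workers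
and the last index to the auxiliary variable. -/
noncomputable def easgdMixingMatrix (m : ℕ) (α : ℝ) :
    Matrix (Fin (m + 1)) (Fin (m + 1)) ℝ := fun i j =>
  if (i : ℕ) < m then
    (if (j : ℕ) < m then (if i = j then 1 - α else 0) else α)
  else
    (if (j : ℕ) < m then α else 1 - (m : ℝ) * α)

lemma easgd_det_aux (m : ℕ) (hm : 2 ≤ m) (α t : ℝ) (ht : t - (1 - α) ≠ 0) :
    (Matrix.scalar (Fin (m + 1)) t - easgdMixingMatrix m α).det
      = (t - (1 - α)) ^ (m - 1) * (t - 1) * (t - (1 - ((m : ℝ) + 1) * α)) := by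
  have h1 : (Matrix.scalar (Fin (m + 1)) t - easgdMixingMatrix m α).submatrix
      (finSumFinEquiv (m := m) (n := 1)) (finSumFinEquiv (m := m) (n := 1))
      = Matrix.fromBlocks ((t - (1 - α)) • (1 : Matrix (Fin m) (Fin m) ℝ))
        (Matrix.of fun _ _ => -α) (Matrix.of fun _ _ => -α)
        (Matrix.of fun _ _ => t - (1 - (m : ℝ) * α)) := by
    ext i j
    rcases i with i | i <;> rcases j with j | j
    · by_cases hij : i = j
      · subst hij
        simp [easgdMixingMatrix]
      · simp [easgdMixingMatrix, hij, Matrix.diagonal_apply, Matrix.one_apply]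
    · have : Fin.castAdd 1 i ≠ Fin.natAdd m j := by
        intro h
        have := congrArg Fin.val h
        simp at this
        omega
      simp [easgdMixingMatrix, Matrix.diagonal_apply, this]
    · have : Fin.natAdd m i ≠ Fin.castAdd 1 j := by
        intro h
        have := congrArg Fin.val h
        simp at this
        omega
      simp [easgdMixingMatrix, Matrix.diagonal_apply, this]
    · have : i = j := Subsingleton.elim _ _
      subst this
      simp [easgdMixingMatrix]
  rw [← Matrix.det_submatrix_equiv_self (finSumFinEquiv (m := m) (n := 1)), h1]
  generalize hs : t - (1 - α) = s at ht
  letI : Invertible (s • (1 : Matrix (Fin m) (Fin m) ℝ)) :=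
    ⟨s⁻¹ • 1, by simp [smul_smul, ht], by simp [smul_smul, ht]⟩
  have h2 : ⅟(s • (1 : Matrix (Fin m) (Fin m) ℝ)) = s⁻¹ • 1 := rfl
  rw [Matrix.det_fromBlocks₁₁, h2]
  obtain ⟨k, rfl⟩ : ∃ k, m = k + 1 := ⟨m - 1, by omega⟩
  obtain rfl : t = s + (1 - α) := by linarith
  simp [Matrix.mul_apply, Matrix.det_fin_one]
  field_simp
  ring

lemma easgd_charpoly_aux (m : ℕ) (hm : 2 ≤ m) (α : ℝ) :
    (easgdMixingMatrix m α).charpoly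
        = (X - C (1 - α)) ^ (m - 1) * (X - C 1) * (X - C (1 - ((m : ℝ) + 1) * α)) := by
  apply mul_left_cancel₀ (X_sub_C_ne_zero (1 - α))
  apply Polynomial.funext
  intro t
  by_cases ht : t - (1 - α) = 0
  · rw [eval_mul, eval_mul]
    simp only [eval_sub, eval_X, eval_C, ht, zero_mul]
  · rw [eval_mul, eval_mul, Matrix.eval_charpoly, easgd_det_aux m hm α t ht]
    simp only [eval_sub, eval_X, eval_C, eval_mul, eval_pow]

lemma easgd_roots_aux (m : ℕ) (hm : 2 ≤ m) (α : ℝ) :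
    (easgdMixingMatrix m α).charpoly.roots.erase 1
        = Multiset.replicate (m - 1) (1 - α) + {1 - ((m : ℝ) + 1) * α} := by
  have hne : ∀ a : ℝ, (X - C a : ℝ[X]) ≠ 0 := X_sub_C_ne_zero
  rw [easgd_charpoly_aux m hm α,
    roots_mul (mul_ne_zero (mul_ne_zero (pow_ne_zero _ (hne _)) (hne _)) (hne _)),
    roots_mul (mul_ne_zero (pow_ne_zero _ (hne _)) (hne _)), roots_pow,
    roots_X_sub_C, roots_X_sub_C, roots_X_sub_C, Multiset.nsmul_singleton,
    add_right_comm, add_comm _ ({1} : Multiset ℝ), Multiset.singleton_add,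
    Multiset.erase_cons_head]

/-- **Eigenvalues of the EASGD mixing matrix.**
For `m ≥ 2` and `0 < α < 2/(m+1)`, the eigenvalues of `W_α` counted with
multiplicity are `1−α` with multiplicity `m−1`, the value `1`, and the value
`1−(m+1)α` (expressed through the factorization of the characteristic polynomial).
Consequently the maximum absolute value among the eigenvalues other than the
single eigenvalue `1` equals `max {|1−α|, |1−(m+1)α|}`. -/
theorem easgd_mixing_matrix_eigenvalues (m : ℕ) (hm : 2 ≤ m) (α : ℝ)
    (hα0 : 0 < α) (hα1 : α < 2 / ((m : ℝ) + 1)) :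
    (easgdMixingMatrix m α).charpoly
        = (X - C (1 - α)) ^ (m - 1) * (X - C 1) * (X - C (1 - ((m : ℝ) + 1) * α)) ∧
    (∀ x ∈ ((easgdMixingMatrix m α).charpoly.roots).erase 1,
        |x| ≤ max |1 - α| |1 - ((m : ℝ) + 1) * α|) ∧
    (∃ x ∈ ((easgdMixingMatrix m α).charpoly.roots).erase 1,
        |x| = max |1 - α| |1 - ((m : ℝ) + 1) * α|) := by
  refine ⟨easgd_charpoly_aux m hm α, ?_, ?_⟩
  · intro x hx
    rw [easgd_roots_aux m hm α, Multiset.mem_add, Multiset.mem_singleton] at hx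
    rcases hx with hx | rfl
    · rw [Multiset.eq_of_mem_replicate hx]
      exact le_max_left _ _
    · exact le_max_right _ _
  · rw [easgd_roots_aux m hm α]
    rcases le_total |1 - α| |1 - ((m : ℝ) + 1) * α| with h | h
    · exact ⟨_, Multiset.mem_add.2 (Or.inr (Multiset.mem_singleton_self _)),
        (max_eq_right h).symm⟩
    · exact ⟨1 - α, Multiset.mem_add.2 (Or.inl (Multiset.mem_replicate.2 ⟨by omega, rfl⟩)),
        (max_eq_left h).symm⟩
end

section
/- Let W be an m×m real symmetric matrix with W·1 = 1 and all eigenvalues in [−1, 1]; let ζ = max{|λ₂(W)|, |λ_m(W)|} where λ₁ ≥ ⋯ ≥ λ_m are its eigenvalues. For 0 ≤ α ≤ 1, define the (m+1)×(m+1) matrix W' = [[(1−α)W, α·1], [α·1ᵀ, 1−mα]]. Then W'·1 = 1, W' is symmetric, and its second largest absolute eigenvalue satisfies ζ' := max{|λ₂(W')|, |λ_{m+1}(W')|} = max{(1−α)ζ, |1−(m+1)α|}. Moreover, setting α = (1+ζ)/(m+1+ζ) minimizes this expression over α and yields the minimum value ζ' = mζ/(m+1+ζ). -/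
open Matrix Polynomial

lemma gea_charpoly_smul {n : ℕ} (W : Matrix (Fin n) (Fin n) ℝ) (lam : Fin n → ℝ)
    (hchar : W.charpoly = ∏ i, (X - C (lam i))) (c : ℝ) :
    (c • W).charpoly = ∏ i, (X - C (c * lam i)) := by
  by_cases hc : c = 0
  · subst hc
    simp [Matrix.charpoly_zero]
  apply Polynomial.funext
  intro t
  have h1 := congrArg (Polynomial.eval (t / c)) hchar
  rw [Matrix.eval_charpoly] at h1 ⊢
  have h2 : Matrix.scalar (Fin n) t - c • W = c • (Matrix.scalar (Fin n) (t / c) - W) := by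
    ext i j
    by_cases hij : i = j
    · subst hij
      simp
      field_simp
    · simp [hij]
  rw [h2, Matrix.det_smul, h1]
  simp only [Polynomial.eval_prod, Polynomial.eval_sub, Polynomial.eval_X, Polynomial.eval_C,
    Fintype.card_fin]
  have h3 : c ^ n = ∏ _i : Fin n, c := by simp
  rw [h3, ← Finset.prod_mul_distrib]
  refine Finset.prod_congr rfl fun i _ => ?_
  field_simp

lemma gea_charpoly_block {m : ℕ} (V : Matrix (Fin m) (Fin m) ℝ) (α : ℝ)
    (hV : V *ᵥ (fun _ => (1 : ℝ)) = fun _ => (1 - α : ℝ)) :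
    (Matrix.fromBlocks V
        (Matrix.of fun _ _ => α : Matrix (Fin m) (Fin 1) ℝ)
        (Matrix.of fun _ _ => α : Matrix (Fin 1) (Fin m) ℝ)
        (Matrix.of fun _ _ => (1 : ℝ) - (m : ℝ) * α)).charpoly * (X - C (1 - α))
      = V.charpoly * ((X - C 1) * (X - C (1 - ((m : ℝ) + 1) * α))) := by
  apply Polynomial.funext
  intro t
  simp only [Polynomial.eval_mul, Matrix.eval_charpoly, Polynomial.eval_sub, Polynomial.eval_X,
    Polynomial.eval_C]
  set A := Matrix.scalar (Fin m) t - V with hA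
  have e1 : Matrix.scalar (Fin m ⊕ Fin 1) t - (Matrix.fromBlocks V
        (Matrix.of fun _ _ => α : Matrix (Fin m) (Fin 1) ℝ)
        (Matrix.of fun _ _ => α : Matrix (Fin 1) (Fin m) ℝ)
        (Matrix.of fun _ _ => (1 : ℝ) - (m : ℝ) * α)) =
      Matrix.fromBlocks A (Matrix.of fun _ _ => -α) (Matrix.of fun _ _ => -α)
        (Matrix.of fun _ _ => t - (1 - m * α)) := by
    ext i j
    rcases i with i | i <;> rcases j with j | j
    · simp [hA, Matrix.diagonal_apply]
    · simp
    · simp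
    · have : i = j := Subsingleton.elim _ _
      subst this
      simp
  have e2 : Matrix.fromBlocks A (Matrix.of fun _ _ => -α) (Matrix.of fun _ _ => -α)
        (Matrix.of fun _ _ => t - (1 - m * α)) *
      Matrix.fromBlocks (1 : Matrix (Fin m) (Fin m) ℝ) (Matrix.of fun _ _ => α)
        (0 : Matrix (Fin 1) (Fin m) ℝ) (Matrix.of fun _ _ => t - (1 - α)) =
      Matrix.fromBlocks A (0 : Matrix (Fin m) (Fin 1) ℝ) (Matrix.of fun _ _ => -α)
        (Matrix.of fun _ _ => (t - 1) * (t - (1 - ((m : ℝ) + 1) * α))) := by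
    rw [Matrix.fromBlocks_multiply]
    congr 1
    · simp
    · ext i j
      have h := congrFun hV i
      simp only [Matrix.mulVec, dotProduct, mul_one] at h
      simp only [Matrix.add_apply, Matrix.mul_apply, Matrix.of_apply, Matrix.zero_apply,
        ← Finset.sum_mul, hA, Matrix.sub_apply, Finset.sum_sub_distrib, h]
      simp [Matrix.diagonal_apply]
      ring
    · simp
    · ext i j
      simp [Matrix.mul_apply]
      ring
  have e3 := congrArg Matrix.det e2
  rw [Matrix.det_mul, Matrix.det_fromBlocks_zero₂₁, Matrix.det_fromBlocks_zero₁₂] at e3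
  simp only [Matrix.det_one, one_mul, Matrix.det_fin_one, Matrix.of_apply] at e3
  rw [e1, e3]

lemma gea_sorted {n : ℕ} (s : Fin (n + 1) → ℝ) (hs : Antitone s) (i : Fin (n + 1)) :
    |s i| ≤ max |s 0| |s (Fin.last n)| := by
  rw [max_comm]
  exact abs_le_max_abs_abs (hs (Fin.le_last i)) (hs (Fin.zero_le i))

/-- **Generalized elastic averaging reduces the second largest absolute eigenvalue.**
Let `W` be an `m×m` real symmetric matrix with `W·1 = 1` and all eigenvalues in
`[−1, 1]`, listed with multiplicity in decreasing order as `λ₁ ≥ ⋯ ≥ λ_m`, and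
let `ζ = max {|λ₂|, |λ_m|}`.  For `0 ≤ α ≤ 1`, the `(m+1)×(m+1)` matrix
`W' = [[(1−α)W, α·1], [α·1ᵀ, 1−mα]]` satisfies `W'·1 = 1`, is symmetric, and
its second largest absolute eigenvalue is
`ζ' = max {(1−α)ζ, |1−(m+1)α|}`.  Moreover `α = (1+ζ)/(m+1+ζ)` minimizes this
expression over `α`, with minimum value `mζ/(m+1+ζ)`. -/
theorem generalized_elastic_averaging (m : ℕ) (hm : 1 < m)
    (W : Matrix (Fin m) (Fin m) ℝ) (hWsymm : W.IsSymm)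
    (hWone : W *ᵥ (fun _ => (1 : ℝ)) = fun _ => (1 : ℝ))
    (lam : Fin m → ℝ) (hanti : Antitone lam)
    (hchar : W.charpoly = ∏ i, (X - C (lam i)))
    (hrange : ∀ i, -1 ≤ lam i ∧ lam i ≤ 1)
    (ζ : ℝ) (hζ : ζ = max |lam ⟨1, hm⟩| |lam ⟨m - 1, by omega⟩|)
    (α : ℝ) (hα0 : 0 ≤ α) (hα1 : α ≤ 1)
    (W' : Matrix (Fin m ⊕ Fin 1) (Fin m ⊕ Fin 1) ℝ)
    (hW' : W' = Matrix.fromBlocks ((1 - α) • W)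
        (α • (fun _ _ => (1 : ℝ) : Matrix (Fin m) (Fin 1) ℝ))
        (α • (fun _ _ => (1 : ℝ) : Matrix (Fin 1) (Fin m) ℝ))
        (fun _ _ => (1 : ℝ) - (m : ℝ) * α)) :
    (W' *ᵥ (fun _ => (1 : ℝ)) = fun _ => (1 : ℝ)) ∧
    W'.IsSymm ∧
    (∃ lam' : Fin (m + 1) → ℝ, Antitone lam' ∧
        W'.charpoly = ∏ i : Fin (m + 1), (X - C (lam' i)) ∧
        max |lam' ⟨1, by omega⟩| |lam' ⟨m, by omega⟩|
          = max ((1 - α) * ζ) |1 - ((m : ℝ) + 1) * α|) ∧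
    (max ((1 - (1 + ζ) / ((m : ℝ) + 1 + ζ)) * ζ)
        |1 - ((m : ℝ) + 1) * ((1 + ζ) / ((m : ℝ) + 1 + ζ))|
      = (m : ℝ) * ζ / ((m : ℝ) + 1 + ζ)) ∧
    (∀ β : ℝ, 0 ≤ β → β ≤ 1 →
      (m : ℝ) * ζ / ((m : ℝ) + 1 + ζ) ≤ max ((1 - β) * ζ) |1 - ((m : ℝ) + 1) * β|) := by
  have hζ0 : 0 ≤ ζ := by rw [hζ]; exact le_trans (abs_nonneg _) (le_max_left _ _)
  have hmpos : (0 : ℝ) < (m : ℝ) + 1 + ζ := by positivity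
  have hW2 : W' = Matrix.fromBlocks ((1 - α) • W)
        (Matrix.of fun _ _ => α : Matrix (Fin m) (Fin 1) ℝ)
        (Matrix.of fun _ _ => α : Matrix (Fin 1) (Fin m) ℝ)
        (Matrix.of fun _ _ => (1 : ℝ) - (m : ℝ) * α) := by
    rw [hW']
    ext i j
    rcases i with i | i <;> rcases j with j | j
    · rfl
    · exact mul_one α
    · exact mul_one α
    · rfl
  clear hW'
  refine ⟨?_, ?_, ?_, ?_, ?_⟩
  · subst hW2
    ext i
    rcases i with i | i
    · have h := congrFun hWone i
      simp only [Matrix.mulVec, dotProduct, mul_one] at h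
      simp [Matrix.mulVec, dotProduct, ← Finset.mul_sum, h]
    · simp [Matrix.mulVec, dotProduct]
  · subst hW2
    rw [Matrix.IsSymm, Matrix.fromBlocks_transpose]
    rw [Matrix.transpose_smul, hWsymm.eq]
    rfl
  · obtain ⟨n, rfl⟩ : ∃ n, m = n + 2 := ⟨m - 2, by omega⟩
    have hl0 : lam 0 = 1 := by
      have hr : W.charpoly.eval 1 = 0 := by
        rw [Matrix.eval_charpoly]
        apply Matrix.exists_mulVec_eq_zero_iff.mp
        refine ⟨fun _ => 1, ?_, ?_⟩
        · intro h
          exact one_ne_zero (congrFun h 0)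
        · rw [Matrix.sub_mulVec, hWone]
          simp
      rw [hchar, Polynomial.eval_prod, Finset.prod_eq_zero_iff] at hr
      obtain ⟨i, -, hi⟩ := hr
      simp only [Polynomial.eval_sub, Polynomial.eval_X, Polynomial.eval_C] at hi
      have h1 := hanti (Fin.zero_le i)
      have h2 := (hrange 0).2
      linarith
    let r : Fin (n + 2) → ℝ :=
      Fin.cons (1 - (((n + 2 : ℕ) : ℝ) + 1) * α) (fun i : Fin (n + 1) => (1 - α) * lam i.succ)
    have hr0 : r 0 = 1 - (((n + 2 : ℕ) : ℝ) + 1) * α := rfl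
    have hrs : ∀ i : Fin (n + 1), r i.succ = (1 - α) * lam i.succ := fun i => rfl
    have hr1 : ∀ i, r i ≤ 1 := by
      intro i
      refine Fin.cases ?_ (fun i => ?_) i
      · rw [hr0]
        have : 0 ≤ (((n + 2 : ℕ) : ℝ) + 1) * α := by positivity
        linarith
      · rw [hrs]
        have := (hrange i.succ).2
        nlinarith
    let σ := Tuple.sort (fun i => -(r i))
    have hσ : Antitone (fun i => r (σ i)) := by
      intro i j hij
      have := Tuple.monotone_sort (fun i => -(r i)) hij
      simpa using this
    refine ⟨Fin.cons 1 (fun i => r (σ i)), ?_, ?_, ?_⟩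
    · intro i j
      refine Fin.cases ?_ (fun i => ?_) i <;> refine Fin.cases ?_ (fun j => ?_) j
      · intro _; exact le_rfl
      · intro _; simpa using hr1 _
      · intro h; simp at h
      · intro h; simpa using hσ (Fin.succ_le_succ_iff.mp h)
    · have hV : ((1 - α) • W) *ᵥ (fun _ => (1 : ℝ)) = fun _ => (1 - α : ℝ) := by
        rw [Matrix.smul_mulVec, hWone]
        ext i; simp
      have hb := gea_charpoly_block ((1 - α) • W) α hV
      rw [← hW2, gea_charpoly_smul W lam hchar, Fin.prod_univ_succ, hl0, mul_one] at hb
      have hne : (X - C (1 - α) : ℝ[X]) ≠ 0 := Polynomial.X_sub_C_ne_zero _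
      apply mul_right_cancel₀ hne
      have hp : ∏ i : Fin (n + 2 + 1),
          (X - C ((Fin.cons 1 (fun i => r (σ i)) : Fin (n + 2 + 1) → ℝ) i))
          = (X - C 1) * ((X - C (1 - (((n + 2 : ℕ) : ℝ) + 1) * α)) *
            ∏ i : Fin (n + 1), (X - C ((1 - α) * lam i.succ))) := by
        rw [Fin.prod_univ_succ]
        simp only [Fin.cons_zero, Fin.cons_succ]
        rw [Equiv.prod_comp σ (fun i => X - C (r i)), Fin.prod_univ_succ, hr0]
        simp only [hrs]
      rw [hb, hp]
      ring
    · have e1 : (Fin.cons 1 (fun i => r (σ i)) : Fin (n + 2 + 1) → ℝ) ⟨1, by omega⟩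
          = r (σ 0) := rfl
      have e2 : (Fin.cons 1 (fun i => r (σ i)) : Fin (n + 2 + 1) → ℝ) ⟨n + 2, by omega⟩
          = r (σ (Fin.last (n + 1))) := rfl
      rw [e1, e2]
      have hz1 : ζ = max |lam (Fin.succ (0 : Fin (n + 1)))| |lam (Fin.last n).succ| := hζ
      have hc : 0 ≤ 1 - α := by linarith
      have hub : ∀ i, |r i| ≤ max ((1 - α) * ζ) |1 - (((n + 2 : ℕ) : ℝ) + 1) * α| := by
        intro i
        refine Fin.cases ?_ (fun i => ?_) i
        · exact le_max_right _ _
        · refine le_trans ?_ (le_max_left _ _)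
          rw [hrs, abs_mul, abs_of_nonneg hc, hz1]
          refine mul_le_mul_of_nonneg_left ?_ hc
          exact gea_sorted (fun i : Fin (n + 1) => lam i.succ)
            (fun a b hab => hanti (Fin.succ_le_succ_iff.mpr hab)) i
      have hlb : ∀ i, |r i| ≤ max |r (σ 0)| |r (σ (Fin.last (n + 1)))| := by
        intro i
        have := gea_sorted (fun i => r (σ i)) hσ (σ.symm i)
        simpa using this
      apply le_antisymm
      · exact max_le (hub _) (hub _)
      · refine max_le ?_ (hlb 0)
        rw [hz1, mul_max_of_nonneg _ _ hc]
        refine max_le ?_ ?_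
        · have := hlb (Fin.succ 0)
          rwa [hrs, abs_mul, abs_of_nonneg hc] at this
        · have := hlb (Fin.last n).succ
          rwa [hrs, abs_mul, abs_of_nonneg hc] at this
  · have e1 : (1 - (1 + ζ) / ((m : ℝ) + 1 + ζ)) * ζ = (m : ℝ) * ζ / ((m : ℝ) + 1 + ζ) := by
      field_simp
      ring
    have e2 : 1 - ((m : ℝ) + 1) * ((1 + ζ) / ((m : ℝ) + 1 + ζ))
        = -((m : ℝ) * ζ / ((m : ℝ) + 1 + ζ)) := by
      field_simp
      ring
    rw [e1, e2, abs_neg, abs_of_nonneg (by positivity), max_self]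
  · intro β _ _
    rw [div_le_iff₀ hmpos]
    have h1 := le_max_left ((1 - β) * ζ) |1 - ((m : ℝ) + 1) * β|
    have h2 := le_max_right ((1 - β) * ζ) |1 - ((m : ℝ) + 1) * β|
    have h3 := neg_abs_le (1 - ((m : ℝ) + 1) * β)
    set M := max ((1 - β) * ζ) |1 - ((m : ℝ) + 1) * β|
    have h4 : ((m : ℝ) + 1) * β - 1 ≤ M := by linarith
    have h5 := mul_le_mul_of_nonneg_left h1 (by positivity : (0 : ℝ) ≤ (m : ℝ) + 1)
    have h6 := mul_le_mul_of_nonneg_left h4 hζ0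
    nlinarith
end

section
/- Let A be a symmetric m×m real matrix with eigenvalues λ₁, λ₂, …, λ_m and let u with ‖u‖ = 1 be a unit eigenvector of A for λ₁; let B be a symmetric n×n real matrix with eigenvalues β₁, β₂, …, β_n and let v with ‖v‖ = 1 be a unit eigenvector of B for β₁. Then for any real ρ, the (m+n)×(m+n) block matrix C = [[A, ρuvᵀ], [ρvuᵀ, B]] has eigenvalues (with multiplicity) λ₂, …, λ_m, β₂, …, β_n, γ₁, γ₂, where γ₁, γ₂ are the eigenvalues of the 2×2 matrix [[λ₁, ρ], [ρ, β₁]]. -/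
open Matrix Polynomial

theorem fiedler_aux_det {m n : ℕ} (P : Matrix (Fin m) (Fin m) ℝ) (Q : Matrix (Fin n) (Fin n) ℝ)
    (u : Fin m → ℝ) (v : Fin n → ℝ) (hu : u ⬝ᵥ u = 1) (hv : v ⬝ᵥ v = 1) (p q r : ℝ)
    (hP : P.det ≠ 0) (hp : p ≠ 0) (hq : q ≠ 0)
    (hPu : P *ᵥ u = p • u) (hQv : Q *ᵥ v = q • v) :
    (Matrix.fromBlocks P (r • vecMulVec u v) (r • vecMulVec v u) Q).det * (p * q)
      = P.det * Q.det * (p * q - r ^ 2) := by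
  haveI : Invertible P := P.invertibleOfIsUnitDet (isUnit_iff_ne_zero.mpr hP)
  have hPi : ⅟P *ᵥ u = p⁻¹ • u := by
    have h : ⅟P *ᵥ (P *ᵥ u) = u := by rw [Matrix.mulVec_mulVec, invOf_mul_self, Matrix.one_mulVec]
    rw [hPu, Matrix.mulVec_smul] at h
    rw [← h, smul_smul, inv_mul_cancel₀ hp, one_smul, h]
  have h2 : Q - (r • vecMulVec v u) * ⅟P * (r • vecMulVec u v)
      = Q * (1 + replicateCol Unit ((-(r ^ 2 / (p * q))) • v) * replicateRow Unit v) := by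
    rw [Matrix.mul_assoc, Matrix.mul_smul, Matrix.mul_vecMulVec, hPi, Matrix.smul_mul,
      Matrix.mul_smul, vecMulVec_mul_vecMulVec, dotProduct_smul, hu, Matrix.mul_add, Matrix.mul_one,
      ← vecMulVec_eq, Matrix.mul_vecMulVec, Matrix.mulVec_smul, hQv, sub_eq_add_neg]
    congr 1
    ext i j
    simp [vecMulVec_apply]
    field_simp
  rw [Matrix.det_fromBlocks₁₁, h2, Matrix.det_mul, det_one_add_replicateCol_mul_replicateRow,
    dotProduct_smul, hv]
  simp
  field_simp
  ring

/-- **Fiedler's lemma on eigenvalues of a bordered block matrix.**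
Let `A` be a symmetric `m×m` matrix with eigenvalues `λ₁, …, λ_m` (with
multiplicity, encoded by the factorization of the characteristic polynomial)
and unit eigenvector `u` for `λ₁`, and let `B` be a symmetric `n×n` matrix with
eigenvalues `β₁, …, β_n` and unit eigenvector `v` for `β₁`.  Then for any real
`ρ`, the block matrix `C = [[A, ρuvᵀ], [ρvuᵀ, B]]` has eigenvalues (with
multiplicity) `λ₂, …, λ_m, β₂, …, β_n, γ₁, γ₂`, where `γ₁, γ₂` are the
eigenvalues of the `2×2` matrix `[[λ₁, ρ], [ρ, β₁]]`. -/
theorem fiedler_block_eigenvalues (m n : ℕ) (hm : 0 < m) (hn : 0 < n)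
    (A : Matrix (Fin m) (Fin m) ℝ) (hA : A.IsSymm)
    (B : Matrix (Fin n) (Fin n) ℝ) (hB : B.IsSymm)
    (lamA : Fin m → ℝ) (lamB : Fin n → ℝ)
    (hAchar : A.charpoly = ∏ i, (X - C (lamA i)))
    (hBchar : B.charpoly = ∏ j, (X - C (lamB j)))
    (u : Fin m → ℝ) (hu : ∑ i, u i ^ 2 = 1)
    (v : Fin n → ℝ) (hv : ∑ j, v j ^ 2 = 1)
    (huA : A *ᵥ u = lamA ⟨0, hm⟩ • u)
    (hvB : B *ᵥ v = lamB ⟨0, hn⟩ • v)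
    (ρ : ℝ) :
    (Matrix.fromBlocks A (ρ • vecMulVec u v) (ρ • vecMulVec v u) B).charpoly
      = (!![lamA ⟨0, hm⟩, ρ; ρ, lamB ⟨0, hn⟩]).charpoly
          * (∏ i ∈ Finset.univ.erase ⟨0, hm⟩, (X - C (lamA i)))
          * (∏ j ∈ Finset.univ.erase ⟨0, hn⟩, (X - C (lamB j))) := by
  have hu' : u ⬝ᵥ u = 1 := by rw [← hu]; simp [dotProduct, sq]
  have hv' : v ⬝ᵥ v = 1 := by rw [← hv]; simp [dotProduct, sq]
  have eA : A.charpoly = (X - C (lamA ⟨0, hm⟩)) *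
      ∏ i ∈ Finset.univ.erase ⟨0, hm⟩, (X - C (lamA i)) := by
    rw [hAchar, Finset.mul_prod_erase _ (fun i => X - C (lamA i)) (Finset.mem_univ _)]
  have eB : B.charpoly = (X - C (lamB ⟨0, hn⟩)) *
      ∏ i ∈ Finset.univ.erase ⟨0, hn⟩, (X - C (lamB i)) := by
    rw [hBchar, Finset.mul_prod_erase _ (fun i => X - C (lamB i)) (Finset.mem_univ _)]
  generalize (∏ i ∈ Finset.univ.erase ⟨0, hm⟩, (X - C (lamA i))) = FA at *
  generalize (∏ i ∈ Finset.univ.erase ⟨0, hn⟩, (X - C (lamB i))) = FB at *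
  generalize lamA ⟨0, hm⟩ = a at *
  generalize lamB ⟨0, hn⟩ = b at *
  have h0 : A.charpoly * B.charpoly ≠ 0 :=
    mul_ne_zero (A.charpoly_monic.ne_zero) (B.charpoly_monic.ne_zero)
  apply mul_right_cancel₀ h0
  apply Polynomial.funext
  intro x
  rw [eval_mul, eval_mul (p := _ * FB)]
  by_cases hx : (A.charpoly * B.charpoly).eval x = 0
  · rw [hx, mul_zero, mul_zero]
  congr 1
  rw [eval_mul] at hx
  have hxA : A.charpoly.eval x ≠ 0 := left_ne_zero_of_mul hx
  have hxB : B.charpoly.eval x ≠ 0 := right_ne_zero_of_mul hx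
  have eA' : A.charpoly.eval x = (x - a) * FA.eval x := by rw [eA]; simp
  have eB' : B.charpoly.eval x = (x - b) * FB.eval x := by rw [eB]; simp
  have hp : x - a ≠ 0 := by rw [eA'] at hxA; exact left_ne_zero_of_mul hxA
  have hq : x - b ≠ 0 := by rw [eB'] at hxB; exact left_ne_zero_of_mul hxB
  have key := fiedler_aux_det (Matrix.scalar _ x - A) (Matrix.scalar _ x - B) u v hu' hv'
    (x - a) (x - b) (-ρ) (by rwa [← Matrix.eval_charpoly]) hp hq
    (by rw [Matrix.sub_mulVec, huA, sub_smul]; simp [Matrix.scalar_apply, ← Matrix.smul_one_eq_diagonal, Matrix.smul_mulVec])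
    (by rw [Matrix.sub_mulVec, hvB, sub_smul]; simp [Matrix.scalar_apply, ← Matrix.smul_one_eq_diagonal, Matrix.smul_mulVec])
  have hC : Matrix.scalar (Fin m ⊕ Fin n) x
      - Matrix.fromBlocks A (ρ • vecMulVec u v) (ρ • vecMulVec v u) B
      = Matrix.fromBlocks (Matrix.scalar _ x - A) (-ρ • vecMulVec u v) (-ρ • vecMulVec v u)
        (Matrix.scalar _ x - B) := by
    ext i j
    rcases i with i | i <;> rcases j with j | j <;> simp [Matrix.diagonal_apply]
  rw [← Matrix.eval_charpoly, ← Matrix.eval_charpoly, ← hC, ← Matrix.eval_charpoly, eA', eB'] at key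
  have h2 : (!![a, ρ; ρ, b]).charpoly.eval x = (x - a) * (x - b) - ρ ^ 2 := by
    rw [Matrix.eval_charpoly, Matrix.det_fin_two]
    simp
    ring
  apply mul_right_cancel₀ (mul_ne_zero hp hq)
  rw [key, eval_mul, eval_mul, h2]
  ring
end
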